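/- Let v be a Barabanov norm and let x be a v-extremal solution, associated with a switching signal A(·), starting at a point x₀ ≠ 0 at which v is Fréchet differentiable. Then: (1) v is Fréchet differentiable at x(t) for every t ≥ 0; (2) any solution l of the adjoint system associated with A(·) satisfying l(t) ∈ ∂v(x(t)) for all t ≥ 0 is equal to t ↦ ∇v(x(t)) (in particular such l is unique); (3) if moreover Condition G holds, then x is the unique v-extremal solution starting at x₀. -/

import Mathlib

open MeasureTheory Filter Topology RealInnerProductSpace Matrix

noncomputable section

abbrev Vec (n : ℕ) := EuclideanSpace ℝ (Fin n)

def mulE {n : ℕ} (A : Matrix (Fin n) (Fin n) ℝ) (y : Vec n) : Vec n :=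
  Matrix.toEuclideanLin A y

def IsSolutionWith {n : ℕ} (M : Set (Matrix (Fin n) (Fin n) ℝ))
    (A : ℝ → Matrix (Fin n) (Fin n) ℝ) (x : ℝ → Vec n) : Prop :=
  (∀ i j, Measurable fun t => A t i j) ∧ (∀ t, A t ∈ M) ∧
    ContinuousOn x (Set.Ici 0) ∧
    ∀ t ≥ (0:ℝ), x t = x 0 + ∫ s in (0:ℝ)..t, mulE (A s) (x s)

def IsSolution {n : ℕ} (M : Set (Matrix (Fin n) (Fin n) ℝ)) (x : ℝ → Vec n) : Prop :=
  ∃ A, IsSolutionWith M A x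

def IsAdjointWith {n : ℕ} (A : ℝ → Matrix (Fin n) (Fin n) ℝ) (l : ℝ → Vec n) : Prop :=
  ContinuousOn l (Set.Ici 0) ∧
    ∀ t ≥ (0:ℝ), l t = l 0 - ∫ s in (0:ℝ)..t, mulE ((A s)ᵀ) (l s)

def IsNorm {n : ℕ} (v : Vec n → ℝ) : Prop :=
  (∀ x, v x = 0 ↔ x = 0) ∧ (∀ (a : ℝ) (x : Vec n), v (a • x) = |a| * v x) ∧
    ∀ x y, v (x + y) ≤ v x + v y

def IsBarabanov {n : ℕ} (M : Set (Matrix (Fin n) (Fin n) ℝ)) (v : Vec n → ℝ) : Prop :=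
  IsNorm v ∧ (∀ x, IsSolution M x → ∀ t ≥ (0:ℝ), v (x t) ≤ v (x 0)) ∧
    ∀ y : Vec n, ∃ x, IsSolution M x ∧ x 0 = y ∧ ∀ t ≥ (0:ℝ), v (x t) = v y

def IsExtremal {n : ℕ} (M : Set (Matrix (Fin n) (Fin n) ℝ)) (v : Vec n → ℝ)
    (x : ℝ → Vec n) : Prop :=
  IsSolution M x ∧ ∀ t ≥ (0:ℝ), v (x t) = v (x 0)

def subdiff {n : ℕ} (v : Vec n → ℝ) (x : Vec n) : Set (Vec n) :=
  {l | ⟪l, x⟫ = v x ∧ ∀ y, ⟪l, y⟫ ≤ v y}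

def MIrreducible {n : ℕ} (M : Set (Matrix (Fin n) (Fin n) ℝ)) : Prop :=
  ∀ W : Submodule ℝ (Vec n), (∀ A ∈ M, ∀ x ∈ W, mulE A x ∈ W) → W = ⊥ ∨ W = ⊤

def rhoZero {n : ℕ} (M : Set (Matrix (Fin n) (Fin n) ℝ)) : Prop :=
  sSup {r : EReal | ∃ x, IsSolution M x ∧ x 0 ≠ 0 ∧
      r = limsup (fun t => ((Real.log ‖x t‖ / t : ℝ) : EReal)) atTop} = 0

def MaxCondWith {n : ℕ} (M : Set (Matrix (Fin n) (Fin n) ℝ))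
    (A : ℝ → Matrix (Fin n) (Fin n) ℝ) (x l : ℝ → Vec n) : Prop :=
  ∀ᵐ t ∂(volume.restrict (Set.Ici (0:ℝ))),
    ∀ B ∈ M, ⟪l t, mulE B (x t)⟫ ≤ ⟪l t, mulE (A t) (x t)⟫

def ConditionG {n : ℕ} (M : Set (Matrix (Fin n) (Fin n) ℝ)) : Prop :=
  ∀ (x₀ l₀ : Vec n), x₀ ≠ 0 → l₀ ≠ 0 →
  ∀ A₁ A₂ (x₁ x₂ l₁ l₂ : ℝ → Vec n),
    IsSolutionWith M A₁ x₁ → IsSolutionWith M A₂ x₂ →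
    IsAdjointWith A₁ l₁ → IsAdjointWith A₂ l₂ →
    x₁ 0 = x₀ → x₂ 0 = x₀ → l₁ 0 = l₀ → l₂ 0 = l₀ →
    MaxCondWith M A₁ x₁ l₁ → MaxCondWith M A₂ x₂ l₂ →
    ∀ t ≥ (0:ℝ), x₁ t = x₂ t ∧ l₁ t = l₂ t

def omegaLimitSet {n : ℕ} (x : ℝ → Vec n) : Set (Vec n) :=
  {p | ∃ tk : ℕ → ℝ, Tendsto tk atTop atTop ∧ Tendsto (fun k => x (tk k)) atTop (𝓝 p)}

section LinearSystem

variable {E : Type*} [NormedAddCommGroup E] [InnerProductSpace ℝ E]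
  {C : ℝ → E →L[ℝ] E} {K : ℝ} {x l : ℝ → E}

/-- Carathéodory solutions on `[0, ∞)` of the linear equation `x' = C t x`. -/
def IsLinearSolution (C : ℝ → E →L[ℝ] E) (x : ℝ → E) : Prop :=
  ContinuousOn x (Set.Ici 0) ∧ ∀ t ≥ (0:ℝ), x t = x 0 + ∫ s in (0:ℝ)..t, C s (x s)

lemma intervalIntegrable_clm_apply (hC : StronglyMeasurable C) (hK : ∀ t, ‖C t‖ ≤ K)
    (hx : ContinuousOn x (Set.Ici 0)) {a b : ℝ} (ha : 0 ≤ a) (hb : 0 ≤ b) :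
    IntervalIntegrable (fun s => C s (x s)) volume a b := by
  have hsub : Set.uIcc a b ⊆ Set.Ici 0 := fun s hs => (le_min ha hb).trans hs.1
  have hxab : ContinuousOn x (Set.uIcc a b) := hx.mono hsub
  obtain ⟨R, hR⟩ := isCompact_uIcc.exists_bound_of_continuousOn hxab
  rw [intervalIntegrable_iff]
  have hxm : AEStronglyMeasurable x (volume.restrict (Set.uIoc a b)) :=
    (hxab.mono Set.uIoc_subset_uIcc).aestronglyMeasurable measurableSet_uIoc
  refine IntegrableOn.of_bound (by simp [Set.uIoc]) ?_ (K * R) ?_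
  · exact isBoundedBilinearMap_apply.continuous.comp_aestronglyMeasurable₂
      hC.aestronglyMeasurable hxm
  · refine (ae_restrict_iff' measurableSet_uIoc).2 (Eventually.of_forall fun s hs => ?_)
    have h₁ := hR s (Set.uIoc_subset_uIcc hs)
    calc ‖C s (x s)‖ ≤ ‖C s‖ * ‖x s‖ := (C s).le_opNorm _
      _ ≤ K * R := mul_le_mul (hK s) h₁ (norm_nonneg _) ((norm_nonneg _).trans (hK s))

lemma IsLinearSolution.sub_eq_integral (hC : StronglyMeasurable C) (hK : ∀ t, ‖C t‖ ≤ K)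
    (hx : IsLinearSolution C x) {a b : ℝ} (ha : 0 ≤ a) (hb : 0 ≤ b) :
    x b - x a = ∫ s in a..b, C s (x s) := by
  rw [hx.2 b hb, hx.2 a ha, add_sub_add_left_eq_sub,
    intervalIntegral.integral_interval_sub_left] <;>
  exact intervalIntegrable_clm_apply hC hK hx.1 le_rfl ‹_›

lemma IsLinearSolution.exists_norm_sub_le (hC : StronglyMeasurable C) (hK : ∀ t, ‖C t‖ ≤ K)
    (hx : IsLinearSolution C x) (T : ℝ) :
    ∃ R, (∀ t ∈ Set.Icc 0 T, ‖x t‖ ≤ R) ∧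
      ∀ s ∈ Set.Icc 0 T, ∀ t ∈ Set.Icc 0 T, ‖x t - x s‖ ≤ K * R * |t - s| := by
  obtain ⟨R, hR⟩ := isCompact_Icc.exists_bound_of_continuousOn
    (hx.1.mono (fun t (ht : t ∈ Set.Icc 0 T) => ht.1))
  refine ⟨R, hR, fun s hs t ht => ?_⟩
  rw [hx.sub_eq_integral hC hK hs.1 ht.1]
  refine intervalIntegral.norm_integral_le_of_norm_le_const fun r hr => ?_
  have hr' : r ∈ Set.Icc 0 T := Set.uIcc_subset_Icc hs ht (Set.uIoc_subset_uIcc hr)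
  exact ((C r).le_opNorm _).trans
    (mul_le_mul (hK r) (hR r hr') (norm_nonneg _) ((norm_nonneg _).trans (hK r)))

lemma IsLinearSolution.ae_hasDerivAt [CompleteSpace E] (hC : StronglyMeasurable C)
    (hK : ∀ t, ‖C t‖ ≤ K)
    (hx : IsLinearSolution C x) :
    ∀ᵐ t ∂(volume.restrict (Set.Ioi (0:ℝ))), HasDerivAt x (C t (x t)) t := by
  have key : ∀ᵐ t, ∀ N : ℕ, t ∈ Set.uIcc (0:ℝ) N →
      HasDerivAt (fun r => ∫ s in (0:ℝ)..r, C s (x s)) (C t (x t)) t := by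
    rw [ae_all_iff]
    intro N
    filter_upwards [(intervalIntegrable_clm_apply hC hK hx.1 le_rfl
      (Nat.cast_nonneg N)).ae_hasDerivAt_integral] with t ht htN
    exact ht htN 0 Set.left_mem_uIcc
  rw [ae_restrict_iff' measurableSet_Ioi]
  filter_upwards [key] with t ht (ht0 : 0 < t)
  obtain ⟨N, hN⟩ := exists_nat_ge t
  have hd := (ht N (Set.mem_uIcc_of_le ht0.le hN)).const_add (x 0)
  refine hd.congr_of_eventuallyEq ?_
  filter_upwards [lt_mem_nhds ht0] with r hr using hx.2 r hr.le

/-- Solutions of `x' = C t x` and of the adjoint equation `l' = -(C t)† l` have constant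
pairing. -/
lemma IsLinearSolution.inner_eq [CompleteSpace E] (hC : StronglyMeasurable C)
    (hK : ∀ t, ‖C t‖ ≤ K)
    {D : ℝ → E →L[ℝ] E} (hD : StronglyMeasurable D) (hKD : ∀ t, ‖D t‖ ≤ K)
    (hCD : ∀ t a b, ⟪D t a, b⟫ = -⟪a, C t b⟫)
    (hx : IsLinearSolution C x) (hl : IsLinearSolution D l) {t : ℝ} (ht : 0 ≤ t) :
    ⟪l t, x t⟫ = ⟪l 0, x 0⟫ := by
  obtain ⟨R, hR, hxL⟩ := hx.exists_norm_sub_le hC hK t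
  obtain ⟨S, hS, hlL⟩ := hl.exists_norm_sub_le hD hKD t
  have hlip : LipschitzOnWith (K * S * R + S * (K * R)).toNNReal (fun s => ⟪l s, x s⟫)
      (Set.uIcc 0 t) := by
    rw [Set.uIcc_of_le ht]
    refine LipschitzOnWith.of_dist_le_mul fun r hr s hs => ?_
    have hsplit : ⟪l r, x r⟫ - ⟪l s, x s⟫ = ⟪l r - l s, x r⟫ + ⟪l s, x r - x s⟫ := by
      rw [inner_sub_left, inner_sub_right]; ring
    have hS0 : 0 ≤ S := (norm_nonneg _).trans (hS s hs)
    have h₁ : |⟪l r - l s, x r⟫| ≤ K * S * |r - s| * R :=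
      (abs_real_inner_le_norm _ _).trans
        (mul_le_mul (hlL s hs r hr) (hR r hr) (norm_nonneg _)
          ((norm_nonneg _).trans (hlL s hs r hr)))
    have h₂ : |⟪l s, x r - x s⟫| ≤ S * (K * R * |r - s|) :=
      (abs_real_inner_le_norm _ _).trans
        (mul_le_mul (hS s hs) (hxL s hs r hr) (norm_nonneg _) hS0)
    rw [Real.dist_eq, Real.dist_eq, hsplit]
    calc _ ≤ _ := (abs_add_le _ _).trans (add_le_add h₁ h₂)
      _ = (K * S * R + S * (K * R)) * |r - s| := by ring
      _ ≤ _ := mul_le_mul_of_nonneg_right (Real.le_coe_toNNReal _) (abs_nonneg _)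
  have hderiv : ∀ᵐ s, s ∈ Set.uIcc 0 t → HasDerivAt (fun s => ⟪l s, x s⟫) 0 s := by
    have hne : ∀ᵐ s : ℝ, s ≠ 0 := by simp [ae_iff, measure_singleton]
    filter_upwards [(ae_restrict_iff' measurableSet_Ioi).1 (hx.ae_hasDerivAt hC hK),
      (ae_restrict_iff' measurableSet_Ioi).1 (hl.ae_hasDerivAt hD hKD), hne]
      with s hxs hls hs0 hs
    rw [Set.uIcc_of_le ht] at hs
    have hs' : s ∈ Set.Ioi (0:ℝ) := lt_of_le_of_ne hs.1 hs0.symm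
    convert! (hls hs').inner ℝ (hxs hs') using 1
    rw [hCD, add_neg_cancel]
  obtain ⟨c, hc⟩ := hlip.absolutelyContinuousOnInterval.const_of_ae_hasDerivAt_zero hderiv
  exact (hc t Set.right_mem_uIcc).trans (hc 0 Set.left_mem_uIcc).symm

open scoped BoundedContinuousFunction

lemma norm_integral_exp_le {f : ℝ → E} {R t : ℝ} (hK : 0 < K) (ht : 0 ≤ t)
    (hf : ∀ s ∈ Set.Ioc 0 t, ‖f s‖ ≤ K * R) (hR : 0 ≤ R) :
    ‖Real.exp (-(2 * K) * t) • ∫ s in (0:ℝ)..t, Real.exp (2 * K * s) • f s‖ ≤ 1 / 2 * R := by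
  have hi : ∫ s in (0:ℝ)..t, Real.exp (2 * K * s) * (K * R)
      = (Real.exp (2 * K * t) - 1) / 2 * R := by
    rw [intervalIntegral.integral_mul_const,
      intervalIntegral.integral_comp_mul_left (fun s => Real.exp s) (by positivity)]
    simp only [integral_exp, smul_eq_mul, mul_zero, Real.exp_zero]
    field_simp
  have hle : ‖∫ s in (0:ℝ)..t, Real.exp (2 * K * s) • f s‖
      ≤ ∫ s in (0:ℝ)..t, Real.exp (2 * K * s) * (K * R) := by
    refine intervalIntegral.norm_integral_le_of_norm_le ht
      (Eventually.of_forall fun s hs => ?_)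
      (Continuous.intervalIntegrable (by fun_prop) _ _)
    rw [norm_smul, Real.norm_of_nonneg (Real.exp_nonneg _)]
    exact mul_le_mul_of_nonneg_left (hf s hs) (Real.exp_nonneg _)
  rw [norm_smul, Real.norm_of_nonneg (Real.exp_nonneg _)]
  have he : Real.exp (-(2 * K) * t) * Real.exp (2 * K * t) = 1 := by
    rw [← Real.exp_add]; simp
  calc _ ≤ Real.exp (-(2 * K) * t) * ((Real.exp (2 * K * t) - 1) / 2 * R) :=
        mul_le_mul_of_nonneg_left (hle.trans_eq hi) (Real.exp_nonneg _)
    _ = (1 - Real.exp (-(2 * K) * t)) / 2 * R := by linear_combination R / 2 * he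
    _ ≤ _ := by
        refine mul_le_mul_of_nonneg_right ?_ hR
        linarith [Real.exp_nonneg (-(2 * K) * t)]

/-- The weighted Volterra operator of the linear equation `x' = C t x`: a contraction on bounded
continuous functions once `‖C t‖ ≤ K`. -/
lemma exists_weighted_volterra (hC : StronglyMeasurable C) (hK0 : 0 < K) (hK : ∀ t, ‖C t‖ ≤ K) :
    ∃ V : (ℝ →ᵇ E) →L[ℝ] (ℝ →ᵇ E), ‖V‖ < 1 ∧ ∀ u t, 0 ≤ t →
      V u t = Real.exp (-(2 * K) * t) • ∫ s in (0:ℝ)..t, Real.exp (2 * K * s) • C s (u s) := by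
  have hint : ∀ (u : ℝ →ᵇ E) (a b : ℝ),
      IntervalIntegrable (fun s => Real.exp (2 * K * s) • C s (u s)) volume a b := by
    intro u a b
    refine IntervalIntegrable.continuousOn_smul ?_ (by fun_prop)
    rw [intervalIntegrable_iff]
    refine IntegrableOn.of_bound (by simp [Set.uIoc]) ?_ (K * ‖u‖) ?_
    · exact isBoundedBilinearMap_apply.continuous.comp_aestronglyMeasurable₂
        hC.aestronglyMeasurable u.continuous.aestronglyMeasurable
    · exact Eventually.of_forall fun s => ((C s).le_opNorm _).trans
        (mul_le_mul (hK s) (u.norm_coe_le_norm s) (norm_nonneg _) hK0.le)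
  have hbound : ∀ (u : ℝ →ᵇ E) (t : ℝ), 0 ≤ t →
      ‖Real.exp (-(2 * K) * t) • ∫ s in (0:ℝ)..t, Real.exp (2 * K * s) • C s (u s)‖
        ≤ 1 / 2 * ‖u‖ := fun u t ht =>
    norm_integral_exp_le hK0 ht (fun s _ => ((C s).le_opNorm _).trans
      (mul_le_mul (hK s) (u.norm_coe_le_norm s) (norm_nonneg _) hK0.le)) (norm_nonneg _)
  let F : (ℝ →ᵇ E) → (ℝ →ᵇ E) := fun u =>
    BoundedContinuousFunction.ofNormedAddCommGroup
      (fun t => Real.exp (-(2 * K) * max t 0) •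
        ∫ s in (0:ℝ)..max t 0, Real.exp (2 * K * s) • C s (u s))
      (Continuous.smul (by fun_prop)
        ((intervalIntegral.continuous_primitive (hint u) 0).comp
          (continuous_id.max continuous_const)))
      (1 / 2 * ‖u‖) (fun t => hbound u _ (le_max_right _ _))
  have hF : ∀ u t, F u t = Real.exp (-(2 * K) * max t 0) •
        ∫ s in (0:ℝ)..max t 0, Real.exp (2 * K * s) • C s (u s) := fun u t => rfl
  let L : (ℝ →ᵇ E) →ₗ[ℝ] (ℝ →ᵇ E) :=
    { toFun := F
      map_add' := fun u w => by
        ext t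
        simp only [hF, BoundedContinuousFunction.coe_add, Pi.add_apply, map_add, smul_add]
        rw [intervalIntegral.integral_add (hint u _ _) (hint w _ _), smul_add]
      map_smul' := fun c u => by
        ext t
        simp only [hF, BoundedContinuousFunction.coe_smul, map_smul, RingHom.id_apply]
        simp_rw [smul_comm _ c]
        rw [intervalIntegral.integral_smul, smul_comm] }
  refine ⟨L.mkContinuous (1 / 2) fun u => ?_, ?_, fun u t ht => ?_⟩
  · exact (BoundedContinuousFunction.norm_le (by positivity)).2
      fun t => hbound u _ (le_max_right _ _)
  · exact (LinearMap.mkContinuous_norm_le _ (by norm_num) _).trans_lt (by norm_num)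
  · change F u t = _
    rw [hF, max_eq_left ht]

/-- Existence of the resolvent of a linear equation with bounded measurable coefficients. -/
lemma exists_resolvent [CompleteSpace E] (hC : StronglyMeasurable C) (hK : ∀ t, ‖C t‖ ≤ K) :
    ∃ Φ : ℝ → E →ₗ[ℝ] E, Φ 0 = LinearMap.id ∧ ∀ w, IsLinearSolution C (fun t => Φ t w) := by
  wlog hK0 : 0 < K generalizing K
  · exact this (K := |K| + 1) (fun t => (hK t).trans (by linarith [le_abs_self K])) (by positivity)
  obtain ⟨V, hV1, hV⟩ := exists_weighted_volterra hC hK0 hK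
  let U := Units.oneSub V hV1
  let g : E → (ℝ →ᵇ E) := fun w =>
    BoundedContinuousFunction.ofNormedAddCommGroup
      (fun t => Real.exp (-(2 * K) * max t 0) • w) (by fun_prop) ‖w‖ (fun t => by
        rw [norm_smul, Real.norm_of_nonneg (Real.exp_nonneg _)]
        refine mul_le_of_le_one_left (norm_nonneg _) (Real.exp_le_one_iff.2 ?_)
        have : 0 ≤ K * max t 0 := mul_nonneg hK0.le (le_max_right _ _)
        linarith)
  have hg : ∀ w t, g w t = Real.exp (-(2 * K) * max t 0) • w := fun _ _ => rfl
  have hgadd : ∀ w z, g (w + z) = g w + g z := fun w z => by ext t; simp [hg]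
  have hgsmul : ∀ (c : ℝ) w, g (c • w) = c • g w := fun c w => by
    ext t; simp only [hg, BoundedContinuousFunction.coe_smul]; rw [smul_comm]
  let R : (ℝ →ᵇ E) →L[ℝ] (ℝ →ᵇ E) := ↑U⁻¹
  have hR : ∀ w t, 0 ≤ t → R (g w) t = Real.exp (-(2 * K) * t) •
      (w + ∫ s in (0:ℝ)..t, Real.exp (2 * K * s) • C s (R (g w) s)) := by
    intro w t ht
    have h₁ : (1 - V) (R (g w)) = g w := by
      change ((1 - V) * R) (g w) = g w
      rw [show (1 - V) * R = 1 from U.mul_inv]; rfl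
    have h₂ : R (g w) t - V (R (g w)) t = g w t := by
      exact congrArg (fun u : ℝ →ᵇ E => u t) h₁
    rw [smul_add, ← hV _ t ht, eq_add_of_sub_eq h₂, hg, max_eq_left ht]
  have hexp : ∀ t, Real.exp (2 * K * t) * Real.exp (-(2 * K) * t) = 1 := fun t => by
    rw [← Real.exp_add]; simp
  let Φ : ℝ → E →ₗ[ℝ] E := fun t =>
    { toFun := fun w => Real.exp (2 * K * t) • R (g w) t
      map_add' := fun w z => by simp [hgadd]
      map_smul' := fun c w => by
        rw [hgsmul, map_smul, BoundedContinuousFunction.coe_smul, RingHom.id_apply, smul_comm] }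
  have hΦ : ∀ t w, Φ t w = Real.exp (2 * K * t) • R (g w) t := fun _ _ => rfl
  have hint : ∀ w t, 0 ≤ t → Φ t w = w + ∫ s in (0:ℝ)..t, C s (Φ s w) := by
    intro w t ht
    simp only [hΦ, map_smul]
    conv_lhs => rw [hR w t ht, smul_smul, hexp, one_smul]
  have h0 : Φ 0 = LinearMap.id := by
    ext w; simp [hint w 0 le_rfl]
  refine ⟨Φ, h0, fun w => ⟨?_, fun t ht => ?_⟩⟩
  · simp only [hΦ]
    exact (Continuous.smul (by fun_prop) (R (g w)).continuous).continuousOn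
  · simpa only [h0, LinearMap.id_apply] using hint w t ht

end LinearSystem

lemma HasFDerivAt.of_le_of_midpoint_le {E : Type*} [NormedAddCommGroup E] [NormedSpace ℝ E]
    {f g : E → ℝ} {L : E →L[ℝ] ℝ} {p : E} (hf : HasFDerivAt f L p) (hle : ∀ w, g w ≤ f w)
    (heq : g p = f p) (hmid : ∀ h, 2 * g p ≤ g (p + h) + g (p + -h)) : HasFDerivAt g L p := by
  rw [hasFDerivAt_iff_isLittleO_nhds_zero] at hf ⊢
  have hneg : Tendsto (fun h : E => -h) (𝓝 0) (𝓝 0) := by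
    simpa using (continuous_neg (G := E)).tendsto 0
  have hf' := (hf.comp_tendsto hneg).neg_right.norm_left
  simp only [Function.comp_def, neg_neg] at hf'
  refine Asymptotics.IsBigO.trans_isLittleO ?_ (hf.norm_left.add hf')
  refine Asymptotics.IsBigO.of_bound 1 (Eventually.of_forall fun h => ?_)
  simp only [Real.norm_eq_abs, map_neg, one_mul]
  have h₁ := hle (p + h)
  have h₂ := hle (p + -h)
  have h₃ := hmid h
  rw [abs_of_nonneg (a := |_| + |_|) (by positivity), abs_le]
  constructor
  · linarith [le_abs_self (f (p + -h) - f p - -L h), abs_nonneg (f (p + h) - f p - L h)]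
  · linarith [le_abs_self (f (p + h) - f p - L h), abs_nonneg (f (p + -h) - f p - -L h)]

section SwitchedSystem

variable {n : ℕ} {M : Set (Matrix (Fin n) (Fin n) ℝ)} {A : ℝ → Matrix (Fin n) (Fin n) ℝ}
  {v : Vec n → ℝ} {x l : ℝ → Vec n}

lemma IsNorm.two_mul_le (hv : IsNorm v) (a h : Vec n) : 2 * v a ≤ v (a + h) + v (a + -h) := by
  have h₁ := hv.2.2 (a + h) (a + -h)
  have h₂ := hv.2.1 2 a
  rw [show a + h + (a + -h) = (2:ℝ) • a by rw [two_smul]; abel, h₂] at h₁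
  simpa using h₁

lemma toEuclideanCLM_transpose_inner (B : Matrix (Fin n) (Fin n) ℝ) (a b : Vec n) :
    ⟪toEuclideanCLM (𝕜 := ℝ) Bᵀ a, b⟫ = ⟪a, toEuclideanCLM (𝕜 := ℝ) B b⟫ := by
  rw [← conjTranspose_eq_transpose_of_trivial, ← star_eq_conjTranspose, map_star,
    ContinuousLinearMap.star_eq_adjoint, ContinuousLinearMap.adjoint_inner_left]

lemma stronglyMeasurable_toEuclideanCLM (hA : ∀ i j, Measurable fun t => A t i j) :
    StronglyMeasurable fun t => toEuclideanCLM (n := Fin n) (𝕜 := ℝ) (A t) := by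
  have hsum : (fun t => toEuclideanCLM (n := Fin n) (𝕜 := ℝ) (A t)) = fun t =>
      ∑ i, ∑ j, A t i j • toEuclideanCLM (n := Fin n) (𝕜 := ℝ) (Matrix.single i j 1) := by
    ext1 t
    conv_lhs => rw [matrix_eq_sum_single (A t)]
    simp only [map_sum, ← map_smul, smul_single, smul_eq_mul, mul_one]
  rw [hsum]
  refine Finset.stronglyMeasurable_fun_sum _ fun i _ =>
    Finset.stronglyMeasurable_fun_sum _ fun j _ => ?_
  exact (hA i j).stronglyMeasurable.smul_const _

lemma IsCompact.exists_norm_toEuclideanCLM_le (hM : IsCompact M) :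
    ∃ K, ∀ B ∈ M, ‖toEuclideanCLM (n := Fin n) (𝕜 := ℝ) B‖ ≤ K :=
  hM.exists_bound_of_continuousOn (LinearMap.continuous_of_finiteDimensional
    (toEuclideanCLM (n := Fin n) (𝕜 := ℝ)).toAlgEquiv.toLinearMap).continuousOn

lemma isAdjointWith_iff : IsAdjointWith A l ↔
    IsLinearSolution (fun t => -toEuclideanCLM (n := Fin n) (𝕜 := ℝ) (A t)ᵀ) l := by
  refine and_congr_right fun _ => forall₂_congr fun t _ => ?_
  simp only [_root_.neg_apply, intervalIntegral.integral_neg, ← sub_eq_add_neg]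
  rfl

/-- Along an extremal trajectory issued from a point of differentiability, a Barabanov norm stays
differentiable and its gradient solves the adjoint equation. -/
lemma IsBarabanov.exists_adjoint_hasGradientAt (hcpt : IsCompact M) (hv : IsBarabanov M v)
    (hx : IsSolutionWith M A x) (hxe : ∀ t ≥ (0:ℝ), v (x t) = v (x 0))
    (hdiff : DifferentiableAt ℝ v (x 0)) :
    ∃ l, IsAdjointWith A l ∧ l 0 = gradient v (x 0) ∧
      ∀ t ≥ (0:ℝ), HasGradientAt v (l t) (x t) := by
  obtain ⟨K, hKM⟩ := hcpt.exists_norm_toEuclideanCLM_le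
  let C : ℝ → Vec n →L[ℝ] Vec n := fun t => toEuclideanCLM (n := Fin n) (𝕜 := ℝ) (A t)
  let D : ℝ → Vec n →L[ℝ] Vec n := fun t => -toEuclideanCLM (n := Fin n) (𝕜 := ℝ) (A t)ᵀ
  have hC : StronglyMeasurable C := stronglyMeasurable_toEuclideanCLM hx.1
  have hD : StronglyMeasurable D :=
    (stronglyMeasurable_toEuclideanCLM (A := fun t => (A t)ᵀ) fun i j => hx.1 j i).neg
  have hK : ∀ t, ‖C t‖ ≤ K := fun t => hKM _ (hx.2.1 t)
  have hCD : ∀ t a b, ⟪D t a, b⟫ = -⟪a, C t b⟫ := fun t a b => by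
    simp only [C, D, _root_.neg_apply, inner_neg_left,
      toEuclideanCLM_transpose_inner]
  have hKD : ∀ t, ‖D t‖ ≤ K := fun t => by
    have : D t = -star (C t) := by
      simp only [C, D, ← map_star, star_eq_conjTranspose, conjTranspose_eq_transpose_of_trivial]
    rw [this, norm_neg, ContinuousLinearMap.star_eq_adjoint, LinearIsometryEquiv.norm_map]
    exact hK t
  obtain ⟨Φ, hΦ0, hΦ⟩ := exists_resolvent hC hK
  obtain ⟨Ψ, hΨ0, hΨ⟩ := exists_resolvent hD hKD
  have hpair : ∀ z, IsLinearSolution C z → ∀ w t, 0 ≤ t → ⟪Ψ t w, z t⟫ = ⟪w, z 0⟫ :=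
    fun z hz w t ht => by
      have := hz.inner_eq hC hK hD hKD hCD (hΨ w) ht
      rwa [hΨ0, LinearMap.id_apply] at this
  refine ⟨fun t => Ψ t (gradient v (x 0)), isAdjointWith_iff.2 (hΨ _), by simp [hΨ0],
    fun t ht => ?_⟩
  let S : Vec n →ₗ[ℝ] Vec n := LinearMap.adjoint (Ψ t)
  have hSz : ∀ z, IsLinearSolution C z → S (z t) = z 0 := fun z hz => by
    refine ext_inner_left ℝ fun w => ?_
    rw [LinearMap.adjoint_inner_right, hpair z hz w t ht]
  have hSΦ : S * Φ t = 1 := by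
    ext1 w
    simpa [hΦ0] using hSz _ (hΦ w)
  have hΦS : ∀ w, Φ t (S w) = w := fun w =>
    LinearMap.congr_fun (mul_eq_one_comm.1 hSΦ) w
  have hSx : S (x t) = x 0 := hSz x hx.2.2
  have hle : ∀ w, v (Φ t w) ≤ v w := fun w => by
    simpa [hΦ0] using hv.2.1 _ ⟨A, hx.1, hx.2.1, hΦ w⟩ t ht
  have hΦx : Φ t (x 0) = x t := by rw [← hSx, hΦS]
  have hgrad := hdiff.hasGradientAt.hasFDerivAt
  have hg : HasFDerivAt (fun w => v (Φ t w)) (InnerProductSpace.toDual ℝ _ (gradient v (x 0)))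
      (x 0) := by
    refine hgrad.of_le_of_midpoint_le hle (by rw [hΦx, hxe t ht]) fun h => ?_
    simpa using hv.1.two_mul_le (Φ t (x 0)) (Φ t h)
  rw [← hSx] at hg
  have hcomp := hg.comp (x t) (LinearMap.toContinuousLinearMap S).hasFDerivAt
  rw [hasGradientAt_iff_hasFDerivAt]
  convert! hcomp using 1
  · ext w; simp [hΦS]
  · ext w
    simp only [ContinuousLinearMap.comp_apply, InnerProductSpace.toDual_apply_apply,
      LinearMap.coe_toContinuousLinearMap', S, LinearMap.adjoint_inner_right, hSx]

lemma IsBarabanov.inner_mulE_nonpos (hv : IsBarabanov M v) {p g : Vec n}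
    (hg : HasGradientAt v g p) {B : Matrix (Fin n) (Fin n) ℝ} (hB : B ∈ M) :
    ⟪g, mulE B p⟫ ≤ 0 := by
  let C : Vec n →L[ℝ] Vec n := toEuclideanCLM (n := Fin n) (𝕜 := ℝ) B
  let z : ℝ → Vec n := fun t => NormedSpace.exp (t • C) p
  have hz : ∀ t, HasDerivAt z (C (z t)) t := fun t =>
    (ContinuousLinearMap.apply ℝ (Vec n) p).hasFDerivAt.comp_hasDerivAt t
      (hasDerivAt_exp_smul_const' (𝕂 := ℝ) C t)
  have hzc : Continuous z := continuous_iff_continuousAt.2 fun t => (hz t).continuousAt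
  have hz0 : z 0 = p := by
    have h0 : (0:ℝ) • C = 0 := zero_smul ℝ C
    simp only [z, h0, NormedSpace.exp_zero, ContinuousLinearMap.one_def,
      ContinuousLinearMap.id_apply]
  have hsol : IsSolution M z := by
    refine ⟨fun _ => B, fun _ _ => measurable_const, fun _ => hB, hzc.continuousOn,
      fun t _ => ?_⟩
    have := intervalIntegral.integral_eq_sub_of_hasDerivAt (fun s _ => hz s)
      ((C.continuous.comp hzc).intervalIntegrable 0 t)
    exact eq_add_of_sub_eq' this.symm
  have hd : HasDerivAt (fun t => v (z t)) ⟪g, C p⟫ 0 := by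
    have hg' : HasFDerivAt v (InnerProductSpace.toDual ℝ _ g) (z 0) := hz0 ▸ hg.hasFDerivAt
    have := hg'.comp_hasDerivAt 0 (hz 0)
    rwa [InnerProductSpace.toDual_apply_apply, hz0] at this
  have hmax : IsLocalMaxOn (fun t => v (z t)) (Set.Icc 0 1) 0 :=
    eventually_nhdsWithin_of_forall fun t ht => hv.2.1 z hsol t ht.1
  have h1 : (1:ℝ) ∈ posTangentConeAt (Set.Icc (0:ℝ) 1) 0 :=
    mem_posTangentConeAt_of_segment_subset (by simp [segment_eq_Icc])
  simpa using! hmax.hasFDerivWithinAt_nonpos hd.hasFDerivAt.hasFDerivWithinAt h1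

lemma IsBarabanov.maxCondWith (hcpt : IsCompact M) (hv : IsBarabanov M v)
    (hx : IsSolutionWith M A x) (hxe : ∀ t ≥ (0:ℝ), v (x t) = v (x 0))
    (hl : ∀ t ≥ (0:ℝ), HasGradientAt v (l t) (x t)) : MaxCondWith M A x l := by
  obtain ⟨K, hKM⟩ := hcpt.exists_norm_toEuclideanCLM_le
  have hsol : IsLinearSolution (fun t => toEuclideanCLM (n := Fin n) (𝕜 := ℝ) (A t)) x := hx.2.2
  rw [MaxCondWith, ← Measure.restrict_congr_set Ioi_ae_eq_Ici]
  filter_upwards [hsol.ae_hasDerivAt (stronglyMeasurable_toEuclideanCLM hx.1)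
    (fun t => hKM _ (hx.2.1 t)), ae_restrict_mem measurableSet_Ioi] with t hd (ht : 0 < t) B hB
  refine (hv.inner_mulE_nonpos (hl t ht.le) hB).trans_eq ?_
  have h₁ := (hl t ht.le).hasFDerivAt.comp_hasDerivAt t hd
  have h₂ : HasDerivAt (v ∘ x) 0 t := (hasDerivAt_const t (v (x 0))).congr_of_eventuallyEq <| by
    filter_upwards [lt_mem_nhds ht] with s hs using hxe s hs.le
  exact h₂.unique h₁

lemma HasGradientAt.eq_of_mem_subdiff {p g k : Vec n} (hg : HasGradientAt v g p)
    (hk : k ∈ subdiff v p) : k = g := by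
  have hmin : IsLocalMin (fun w => v w - InnerProductSpace.toDual ℝ _ k w) p :=
    Eventually.of_forall fun w => by
      simp only [InnerProductSpace.toDual_apply_apply, hk.1, sub_self]
      exact sub_nonneg.2 (hk.2 w)
  have h0 := hmin.hasFDerivAt_eq_zero
    (hg.hasFDerivAt.sub (InnerProductSpace.toDual ℝ (Vec n) k).hasFDerivAt)
  exact ((InnerProductSpace.toDual ℝ (Vec n)).injective (sub_eq_zero.1 h0)).symm

lemma HasGradientAt.ne_zero_of_isNorm (hv : IsNorm v) {p g : Vec n} (hg : HasGradientAt v g p)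
    (hp : p ≠ 0) : g ≠ 0 := by
  rintro rfl
  have hline : HasDerivAt (fun t : ℝ => t • p) p 1 := by
    simpa using (hasDerivAt_id (1:ℝ)).smul_const p
  have hg' : HasFDerivAt v (InnerProductSpace.toDual ℝ (Vec n) 0) ((1:ℝ) • p) := by
    rw [one_smul]; exact hg.hasFDerivAt
  have h₁ : HasDerivAt (fun t : ℝ => v (t • p)) 0 1 := by
    simpa using! hg'.comp_hasDerivAt 1 hline
  have h₂ : HasDerivAt (fun t : ℝ => v (t • p)) (v p) 1 := by
    have : HasDerivAt (fun t : ℝ => t * v p) (v p) 1 := by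
      simpa using (hasDerivAt_id (1:ℝ)).mul_const (v p)
    refine this.congr_of_eventuallyEq ?_
    filter_upwards [lt_mem_nhds (zero_lt_one (α := ℝ))] with t ht
    rw [hv.2.1, abs_of_pos ht]
  exact hp ((hv.1 p).1 (h₂.unique h₁))

end SwitchedSystem

theorem stmt3 (n : ℕ) (hn : 0 < n) (M : Set (Matrix (Fin n) (Fin n) ℝ))
    (hne : M.Nonempty) (hcpt : IsCompact M) (hconv : Convex ℝ M)
    (v : Vec n → ℝ) (hv : IsBarabanov M v)
    (A : ℝ → Matrix (Fin n) (Fin n) ℝ) (x : ℝ → Vec n)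
    (hx : IsSolutionWith M A x) (hxe : ∀ t ≥ (0:ℝ), v (x t) = v (x 0))
    (x₀ : Vec n) (hx0 : x 0 = x₀) (hx0ne : x₀ ≠ 0)
    (hdiff : DifferentiableAt ℝ v x₀) :
    (∀ t ≥ (0:ℝ), DifferentiableAt ℝ v (x t)) ∧
    (∀ l : ℝ → Vec n, IsAdjointWith A l → (∀ t ≥ (0:ℝ), l t ∈ subdiff v (x t)) →
      ∀ t ≥ (0:ℝ), l t = gradient v (x t)) ∧
    (ConditionG M → ∀ y : ℝ → Vec n, IsExtremal M v y → y 0 = x₀ →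
      ∀ t ≥ (0:ℝ), y t = x t) := by
  subst hx0
  obtain ⟨l, hl, hl0, hlv⟩ := hv.exists_adjoint_hasGradientAt hcpt hx hxe hdiff
  refine ⟨fun t ht => (hlv t ht).differentiableAt, fun k _ hk t ht => ?_, ?_⟩
  · exact (hlv t ht).differentiableAt.hasGradientAt.eq_of_mem_subdiff (hk t ht)
  · rintro hG y ⟨⟨B, hy⟩, hye⟩ hy0 t ht
    obtain ⟨k, hk, hk0, hkv⟩ := hv.exists_adjoint_hasGradientAt hcpt hy hye (hy0 ▸ hdiff)
    have hl0ne : l 0 ≠ 0 := (hlv 0 le_rfl).ne_zero_of_isNorm hv.1 hx0ne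
    exact (hG (x 0) (l 0) hx0ne hl0ne B A y x k l hy hx hk hl hy0 rfl
      (by rw [hk0, hl0, hy0]) rfl (hv.maxCondWith hcpt hy hye hkv)
      (hv.maxCondWith hcpt hx hxe hlv) t ht).1
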